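/- arXiv:2603.03396 — 4 statements merged into one kernel-verified Lean document; each statement's English description precedes it below -/
import Mathlib

section
/- The ternary digit frequency function attains every value in [0,1]: for every a ∈ [0,1] and every digit i ∈ {0,1,2} there exists x ∈ [0,1] such that the frequency ν_i(x) exists and ν_i(x) = a. -/
open Filter

/-- The `n`-th ternary digit of `x`: `⌊3^n x⌋ mod 3`. -/
noncomputable def ternDigit (x : ℝ) (n : ℕ) : ℤ := ⌊(3 : ℝ) ^ n * x⌋ % 3

/-- `N_i(x,k)`: the number of indices `1 ≤ n ≤ k` with `α_n(x) = i`. -/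
noncomputable def digitCount (i : ℤ) (x : ℝ) (k : ℕ) : ℕ :=
  ((Finset.Icc 1 k).filter (fun n => ternDigit x n = i)).card

/-- The frequency `ν_i(x)` exists and equals `v`. -/
def hasFreq (i : ℤ) (x : ℝ) (v : ℝ) : Prop :=
  Tendsto (fun k : ℕ => (digitCount i x k : ℝ) / k) atTop (nhds v)

/-- The asymptotic mean of digits `r(x)` exists and equals `r`. -/
def hasMean (x : ℝ) (r : ℝ) : Prop :=
  Tendsto (fun n : ℕ => (1 / (n : ℝ)) * ∑ k ∈ Finset.Icc 1 n, (ternDigit x k : ℝ))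
    atTop (nhds r)

theorem ofDigits_three_mul (d : ℕ → Fin 3) :
    3 * Real.ofDigits d = (d 0 : ℕ) + Real.ofDigits (fun n => d (n + 1)) := by
  rw [Real.ofDigits_eq_sum_add_ofDigits d 1]
  simp [Real.ofDigitsTerm]
  ring

theorem ofDigits_lt_one_of_ne_two (d : ℕ → Fin 3) (m : ℕ) (hm : d m ≠ 2) :
    Real.ofDigits d < 1 := by
  induction m generalizing d with
  | zero =>
    have h := ofDigits_three_mul d
    have h1 := Real.ofDigits_le_one (fun n => d (n + 1))
    have h2 : ((d 0 : ℕ) : ℝ) ≤ 1 := by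
      have : (d 0 : ℕ) ≤ 1 := by omega
      exact_mod_cast this
    linarith
  | succ m ih =>
    have h := ofDigits_three_mul d
    have h1 := ih (fun n => d (n + 1)) hm
    have h2 : ((d 0 : ℕ) : ℝ) ≤ 2 := by
      have : (d 0 : ℕ) ≤ 2 := by omega
      exact_mod_cast this
    linarith

theorem exists_int_add_ofDigits_shift (d : ℕ → Fin 3) (n : ℕ) :
    ∃ M : ℤ, (3 : ℝ) ^ n * Real.ofDigits d = M + Real.ofDigits (fun k => d (k + n)) := by
  induction n with
  | zero => exact ⟨0, by simp⟩
  | succ n ih =>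
    obtain ⟨M, hM⟩ := ih
    refine ⟨3 * M + (d n : ℕ), ?_⟩
    have h := ofDigits_three_mul (fun k => d (k + n))
    have e : (fun k => d (k + 1 + n)) = fun k => d (k + (n + 1)) := by
      funext k
      congr 1
      ring
    simp only [zero_add] at h
    rw [e] at h
    push_cast
    rw [pow_succ', mul_assoc, hM, mul_add, h]
    ring

theorem ternDigit_ofDigits (d : ℕ → Fin 3) (hd : ∀ n, ∃ m, n ≤ m ∧ d m ≠ 2) (n : ℕ) :
    ternDigit (Real.ofDigits d) (n + 1) = (d n : ℕ) := by
  obtain ⟨M, hM⟩ := exists_int_add_ofDigits_shift d n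
  have h := ofDigits_three_mul (fun k => d (k + n))
  obtain ⟨m, hnm, hm⟩ := hd (n + 1)
  have hlt : Real.ofDigits (fun k => d (k + 1 + n)) < 1 := by
    refine ofDigits_lt_one_of_ne_two _ (m - (n + 1)) ?_
    rwa [show m - (n + 1) + 1 + n = m by omega]
  have h0 := Real.ofDigits_nonneg (fun k => d (k + 1 + n))
  simp only [zero_add] at h
  have hfl : ⌊(3 : ℝ) ^ (n + 1) * Real.ofDigits d⌋ = 3 * M + (d n : ℕ) := by
    rw [Int.floor_eq_iff, pow_succ', mul_assoc, hM, mul_add, h]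
    push_cast
    constructor <;> linarith
  have := (d n).isLt
  rw [ternDigit, hfl]
  omega

theorem digitCount_succ (i : ℤ) (x : ℝ) (k : ℕ) :
    digitCount i x (k + 1) = digitCount i x k + if ternDigit x (k + 1) = i then 1 else 0 := by
  unfold digitCount
  rw [← Finset.insert_Icc_right_eq_Icc_add_one (by omega), Finset.filter_insert]
  split_ifs <;> simp

theorem exists_digitCount_eq (i : Fin 3) (f : ℕ → ℕ) (h0 : f 0 = 0) (hmono : Monotone f)
    (hstep : ∀ n, f (n + 1) ≤ f n + 1) (hconst : ∀ n, ∃ m, n ≤ m ∧ f (m + 1) = f m) :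
    ∃ x ∈ Set.Icc (0 : ℝ) 1, ∀ k, digitCount (i : ℕ) x k = f k := by
  obtain ⟨j, hji, hj2⟩ : ∃ j : Fin 3, j ≠ i ∧ j ≠ 2 := by
    fin_cases i
    exacts [⟨1, by decide⟩, ⟨0, by decide⟩, ⟨0, by decide⟩]
  let d : ℕ → Fin 3 := fun n => if f (n + 1) = f n then j else i
  have hd : ∀ n, ∃ m, n ≤ m ∧ d m ≠ 2 := fun n => by
    obtain ⟨m, hnm, hm⟩ := hconst n
    exact ⟨m, hnm, by simpa [d, hm] using hj2⟩
  refine ⟨Real.ofDigits d, ⟨Real.ofDigits_nonneg d, Real.ofDigits_le_one d⟩, fun k => ?_⟩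
  induction k with
  | zero => simp [digitCount, h0]
  | succ k ih =>
    rw [digitCount_succ, ih, ternDigit_ofDigits d hd]
    have h1 := hstep k
    have h2 := hmono (Nat.le_add_right k 1)
    have hji' : (j : ℕ) ≠ i := fun h => hji (Fin.ext h)
    by_cases h : f (k + 1) = f k
    · simp [d, h, hji']
    · simp only [d, h, if_false, if_true]
      omega

/-- A counting function with density `a` that is constant across every perfect square. -/
noncomputable def sparseCount (a : ℝ) (n : ℕ) : ℕ := ⌊a * ((n - Nat.sqrt n : ℕ) : ℝ)⌋₊

theorem sub_sqrt_succ (n : ℕ) :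
    n - Nat.sqrt n ≤ n + 1 - Nat.sqrt (n + 1) ∧
      n + 1 - Nat.sqrt (n + 1) ≤ n - Nat.sqrt n + 1 := by
  have h1 := Nat.sqrt_succ_le_succ_sqrt n
  have h2 := Nat.sqrt_le_sqrt (Nat.le_succ n)
  have h3 := Nat.sqrt_le_self n
  simp only [Nat.succ_eq_add_one] at h1 h2
  omega

theorem monotone_sparseCount {a : ℝ} (ha : 0 ≤ a) : Monotone (sparseCount a) :=
  monotone_nat_of_le_succ fun n => Nat.floor_mono <|
    mul_le_mul_of_nonneg_left (Nat.cast_le.mpr (sub_sqrt_succ n).1) ha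

theorem sparseCount_succ_le {a : ℝ} (ha : 0 ≤ a) (ha1 : a ≤ 1) (n : ℕ) :
    sparseCount a (n + 1) ≤ sparseCount a n + 1 := by
  unfold sparseCount
  rw [← Nat.floor_add_one (by positivity)]
  refine Nat.floor_mono ?_
  have h : ((n + 1 - Nat.sqrt (n + 1) : ℕ) : ℝ) ≤ ((n - Nat.sqrt n : ℕ) : ℝ) + 1 := by
    exact_mod_cast (sub_sqrt_succ n).2
  nlinarith

theorem exists_sparseCount_succ_eq (a : ℝ) (n : ℕ) :
    ∃ m, n ≤ m ∧ sparseCount a (m + 1) = sparseCount a m := by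
  refine ⟨n * n + (n + n), by omega, ?_⟩
  have h1 : Nat.sqrt (n * n + (n + n)) = n := Nat.sqrt_add_eq n le_rfl
  have h2 : Nat.sqrt (n * n + (n + n) + 1) = n + 1 := by
    rw [show n * n + (n + n) + 1 = (n + 1) * (n + 1) by ring, Nat.sqrt_eq]
  unfold sparseCount
  rw [h1, h2, Nat.add_sub_add_right]

theorem tendsto_sparseCount_div {a : ℝ} (ha : 0 ≤ a) :
    Tendsto (fun k : ℕ => (sparseCount a k : ℝ) / k) atTop (nhds a) := by
  have hsqrt : Tendsto (fun k : ℕ => (√(k : ℝ))⁻¹) atTop (nhds 0) :=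
    (Real.tendsto_sqrt_atTop.comp tendsto_natCast_atTop_atTop).inv_tendsto_atTop
  have hinv : Tendsto (fun k : ℕ => ((k : ℝ))⁻¹) atTop (nhds 0) :=
    tendsto_inv_atTop_nhds_zero_nat
  have hlow : Tendsto (fun k : ℕ => a - a * (√(k : ℝ))⁻¹ - (k : ℝ)⁻¹) atTop (nhds a) := by
    simpa using (tendsto_const_nhds (x := a)).sub (hsqrt.const_mul a) |>.sub hinv
  refine tendsto_of_tendsto_of_tendsto_of_le_of_le' hlow tendsto_const_nhds ?_ ?_
  · filter_upwards [eventually_gt_atTop 0] with k hk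
    have hk' : (0 : ℝ) < k := Nat.cast_pos.mpr hk
    have h1 := Nat.lt_floor_add_one (a * ((k - Nat.sqrt k : ℕ) : ℝ))
    rw [Nat.cast_sub (Nat.sqrt_le_self k)] at h1
    have h2 := mul_le_mul_of_nonneg_left (Real.nat_sqrt_le_real_sqrt (a := k)) ha
    have h3 : (√(k : ℝ))⁻¹ * k = √(k : ℝ) := by
      rw [inv_mul_eq_div, Real.div_sqrt]
    rw [le_div_iff₀ hk', sub_mul, sub_mul, mul_assoc, h3, inv_mul_cancel₀ hk'.ne', sparseCount,
      Nat.cast_sub (Nat.sqrt_le_self k)]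
    linarith
  · filter_upwards [eventually_gt_atTop 0] with k hk
    rw [div_le_iff₀ (Nat.cast_pos.mpr hk)]
    refine (Nat.floor_le (by positivity)).trans ?_
    exact mul_le_mul_of_nonneg_left (Nat.cast_le.mpr (Nat.sub_le _ _)) ha

/-- The ternary digit frequency function attains every value in `[0,1]`. -/
theorem freq_attains_all_values (a : ℝ) (ha : a ∈ Set.Icc (0 : ℝ) 1)
    (i : ℤ) (hi : i ∈ ({0, 1, 2} : Set ℤ)) :
    ∃ x ∈ Set.Icc (0 : ℝ) 1, hasFreq i x a := by
  obtain ⟨j, rfl⟩ : ∃ j : Fin 3, i = (j : ℕ) := by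
    rcases hi with rfl | rfl | rfl
    exacts [⟨0, rfl⟩, ⟨1, rfl⟩, ⟨2, rfl⟩]
  obtain ⟨x, hx, hcount⟩ := exists_digitCount_eq j (sparseCount a) (by simp [sparseCount])
    (monotone_sparseCount ha.1) (sparseCount_succ_le ha.1 ha.2) (exists_sparseCount_succ_eq a)
  refine ⟨x, hx, ?_⟩
  simpa only [hasFreq, hcount] using tendsto_sparseCount_div ha.1
end

section
/- For every a ∈ (0,2), the Hausdorff dimension of the set K_a = {x ∈ [0,1] : the frequencies ν_0(x), ν_1(x), ν_2(x) all exist and ν_1(x) + 2·ν_2(x) = a} satisfies dim_H(K_a) ≥ −(1/ln 3)·ln[ ((t−1)/3)^{(t−1)/3} · ((7−3a−t)/6)^{(7−3a−t)/6} · ((1+3a−t)/6)^{(1+3a−t)/6} ], where t = √(1 + 6a − 3a²). -/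
open Filter

open MeasureTheory ProbabilityTheory Topology
open scoped ENNReal NNReal

theorem Real.mul_ofDigits {b : ℕ} (ω : ℕ → Fin b) :
    (b : ℝ) * Real.ofDigits ω = (ω 0 : ℕ) + Real.ofDigits (fun i ↦ ω (i + 1)) := by
  have hb : (b : ℝ) ≠ 0 := by exact_mod_cast (Fin.pos (ω 0)).ne'
  rw [Real.ofDigits_eq_sum_add_ofDigits ω 1]
  simp only [Finset.sum_range_one, Real.ofDigitsTerm]
  simp only [zero_add, pow_one]
  field_simp

theorem Real.ofDigits_lt_one {b : ℕ} (hb : 1 < b) {ω : ℕ → Fin b} {k : ℕ}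
    (hk : (ω k : ℕ) = 0) : Real.ofDigits ω < 1 := by
  rw [← Real.ofDigits_const_last_eq_one' hb]
  have hb' : (1 : ℝ) < b := by exact_mod_cast hb
  refine Summable.tsum_lt_tsum (i := k) (fun i ↦ ?_) ?_
    Real.summable_ofDigitsTerm Real.summable_ofDigitsTerm
  · refine Real.ofDigitsTerm_le.trans (le_of_eq ?_)
    simp [Real.ofDigitsTerm, Nat.cast_sub hb.le]
  · simp only [Real.ofDigitsTerm, hk, Nat.cast_sub hb.le]
    have : 0 < (b : ℝ) - 1 := by linarith
    simp only [Nat.cast_zero, zero_mul, Nat.cast_one]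
    positivity

/-- Digit sequences containing infinitely many zeros, which are therefore the unique proper
expansions of the reals that they represent. -/
def infinitelyManyZeros (b : ℕ) : Set (ℕ → Fin b) := {ω | ∃ᶠ k in atTop, (ω k : ℕ) = 0}

section Digits

variable {b : ℕ} {ω ω' : ℕ → Fin b}

theorem ofDigits_shift_mem_Ico (hb : 1 < b) (hω : ω ∈ infinitelyManyZeros b) (n : ℕ) :
    Real.ofDigits (fun i ↦ ω (i + n)) ∈ Set.Ico (0 : ℝ) 1 := by
  refine ⟨Real.ofDigits_nonneg _, ?_⟩
  obtain ⟨k, hk, h0⟩ := (frequently_atTop.mp hω) n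
  refine Real.ofDigits_lt_one hb (k := k - n) ?_
  simpa [Nat.sub_add_cancel hk] using h0

theorem exists_pow_mul_ofDigits (ω : ℕ → Fin b) (n : ℕ) :
    ∃ m : ℤ, (b : ℝ) ^ n * Real.ofDigits ω = m + Real.ofDigits (fun i ↦ ω (i + n)) := by
  induction n with
  | zero => exact ⟨0, by simp⟩
  | succ n ih =>
    obtain ⟨m, hm⟩ := ih
    refine ⟨b * m + (ω n : ℕ), ?_⟩
    have h := Real.mul_ofDigits (fun i ↦ ω (i + n))
    simp only [zero_add, add_right_comm _ 1 n] at h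
    rw [pow_succ', mul_assoc, hm, mul_add, h]
    push_cast
    simp only [add_assoc]

theorem floor_pow_succ_mul_ofDigits (hb : 1 < b) (hω : ω ∈ infinitelyManyZeros b) (n : ℕ) :
    ⌊(b : ℝ) ^ (n + 1) * Real.ofDigits ω⌋ = b * ⌊(b : ℝ) ^ n * Real.ofDigits ω⌋ + (ω n : ℕ) := by
  obtain ⟨m, hm⟩ := exists_pow_mul_ofDigits ω n
  have h := Real.mul_ofDigits (fun i ↦ ω (i + n))
  simp only [zero_add, add_right_comm _ 1 n] at h
  have h0 : ⌊(b : ℝ) ^ n * Real.ofDigits ω⌋ = m := by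
    rw [hm, Int.floor_intCast_add, Int.floor_eq_zero_iff.mpr (ofDigits_shift_mem_Ico hb hω n),
      add_zero]
  have h1 : (b : ℝ) ^ (n + 1) * Real.ofDigits ω =
      ((b * m + (ω n : ℕ) : ℤ) : ℝ) + Real.ofDigits (fun i ↦ ω (i + (n + 1))) := by
    rw [pow_succ', mul_assoc, hm, mul_add, h]
    push_cast
    simp only [add_assoc]
  rw [h0, h1, Int.floor_intCast_add,
    Int.floor_eq_zero_iff.mpr (ofDigits_shift_mem_Ico hb hω (n + 1)), add_zero]

theorem digits_eq_of_floor_eq (hb : 1 < b) (hω : ω ∈ infinitelyManyZeros b)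
    (hω' : ω' ∈ infinitelyManyZeros b) {n : ℕ}
    (h : ⌊(b : ℝ) ^ n * Real.ofDigits ω⌋ = ⌊(b : ℝ) ^ n * Real.ofDigits ω'⌋) :
    ∀ i < n, ω i = ω' i := by
  induction n with
  | zero => simp
  | succ n ih =>
    rw [floor_pow_succ_mul_ofDigits hb hω, floor_pow_succ_mul_ofDigits hb hω'] at h
    have hlt : ((ω n : ℕ) : ℤ) < b := by exact_mod_cast (ω n).isLt
    have hlt' : ((ω' n : ℕ) : ℤ) < b := by exact_mod_cast (ω' n).isLt
    have hmod := congrArg (· % (b : ℤ)) h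
    simp only [Int.mul_add_emod_self_left] at hmod
    rw [Int.emod_eq_of_lt (by positivity) hlt, Int.emod_eq_of_lt (by positivity) hlt'] at hmod
    have hfl : ⌊(b : ℝ) ^ n * Real.ofDigits ω⌋ = ⌊(b : ℝ) ^ n * Real.ofDigits ω'⌋ := by
      rw [hmod] at h
      exact mul_left_cancel₀ (by exact_mod_cast (by omega : b ≠ 0)) (add_right_cancel h)
    intro i hi
    rcases Nat.lt_succ_iff_lt_or_eq.mp hi with hi | rfl
    · exact ih hfl i hi
    · exact Fin.ext (by exact_mod_cast hmod)

end Digits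

theorem ternDigit_succ_ofDigits {ω : ℕ → Fin 3} (hω : ω ∈ infinitelyManyZeros 3) (n : ℕ) :
    ternDigit (Real.ofDigits ω) (n + 1) = (ω n : ℕ) := by
  have h := floor_pow_succ_mul_ofDigits (by norm_num) hω n
  simp only [Nat.cast_ofNat] at h
  rw [ternDigit, h, Int.mul_add_emod_self_left]
  exact Int.emod_eq_of_lt (by positivity) (by exact_mod_cast (ω n).isLt)

theorem digitCount_ofDigits {ω : ℕ → Fin 3} (hω : ω ∈ infinitelyManyZeros 3) (i : Fin 3)
    (k : ℕ) :
    (digitCount (i : ℕ) (Real.ofDigits ω) k : ℝ) =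
      ∑ j ∈ Finset.range k, if ω j = i then (1 : ℝ) else 0 := by
  rw [digitCount, Finset.natCast_card_filter, Finset.range_eq_Ico,
    Finset.sum_Ico_eq_sum_range, ← Finset.Ico_succ_right_eq_Icc, Finset.sum_Ico_eq_sum_range]
  refine Finset.sum_congr (by simp) fun j _ ↦ ?_
  rw [zero_add, add_comm 1 j, ternDigit_succ_ofDigits hω]
  simp [Fin.ext_iff]

/-- The strong law of large numbers for a function of i.i.d. letters from a finite alphabet. -/
theorem ae_tendsto_average_infinitePi {α : Type*} [Finite α] [MeasurableSpace α]
    [MeasurableSingletonClass α] (ν : Measure α) [IsProbabilityMeasure ν] (f : α → ℝ) :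
    ∀ᵐ ω ∂Measure.infinitePi (fun _ : ℕ ↦ ν),
      Tendsto (fun n : ℕ ↦ (∑ i ∈ Finset.range n, f (ω i)) / n) atTop (𝓝 (∫ x, f x ∂ν)) := by
  have hf : Measurable f := measurable_of_finite f
  have hmp (i : ℕ) := measurePreserving_eval_infinitePi (fun _ : ℕ ↦ ν) i
  have hint : Integrable f ν := .of_finite
  have hmap (i : ℕ) : Measure.map (fun ω ↦ f (ω i)) (Measure.infinitePi (fun _ : ℕ ↦ ν)) =
      Measure.map f ν := by
    conv_rhs => rw [← (hmp i).map_eq, Measure.map_map hf (hmp i).measurable]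
    rfl
  have h := strong_law_ae_real (μ := Measure.infinitePi (fun _ : ℕ ↦ ν)) (fun i ω ↦ f (ω i))
    ((hmp 0).integrable_comp_of_integrable hint)
    (fun i j hij ↦ (iIndepFun_infinitePi (P := fun _ : ℕ ↦ ν) (X := fun _ ↦ f)
      (fun _ ↦ hf)).indepFun hij)
    (fun i ↦ ⟨(hf.comp (hmp i).measurable).aemeasurable, (hf.comp (hmp 0).measurable).aemeasurable,
      (hmap i).trans (hmap 0).symm⟩)
  have hE : ∫ ω, f (ω 0) ∂Measure.infinitePi (fun _ : ℕ ↦ ν) = ∫ x, f x ∂ν := by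
    conv_rhs => rw [← (hmp 0).map_eq]
    rw [integral_map (hmp 0).measurable.aemeasurable hf.aestronglyMeasurable]
  simpa only [hE] using h

/-- If every cylinder of length `n` around a point of `G` has mass at most `q`, then the image of
`P.restrict G` gives mass at most `3 * q` to every set of diameter at most `b ^ (-n)`. -/
theorem map_ofDigits_restrict_le {b : ℕ} (hb : 1 < b) (P : Measure (ℕ → Fin b))
    {G : Set (ℕ → Fin b)} (hG : G ⊆ infinitelyManyZeros b) {n : ℕ} {q : ℝ≥0∞}
    (hcyl : ∀ ω ∈ G, P {ω' | ∀ i < n, ω' i = ω i} ≤ q) {S : Set ℝ}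
    (hS : Metric.ediam S ≤ ENNReal.ofReal (((b : ℝ) ^ n)⁻¹)) :
    (P.restrict G).map Real.ofDigits S ≤ 3 * q := by
  have hmeas : Measurable (Real.ofDigits : (ℕ → Fin b) → ℝ) := by
    exact Real.continuous_ofDigits.measurable
  refine (measure_mono subset_closure).trans ?_
  rw [← Metric.ediam_closure] at hS
  rw [Measure.map_apply hmeas isClosed_closure.measurableSet,
    Measure.restrict_apply (hmeas isClosed_closure.measurableSet)]
  have hcell (m : ℤ) : P {ω ∈ G | ⌊(b : ℝ) ^ n * Real.ofDigits ω⌋ = m} ≤ q := by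
    rcases Set.eq_empty_or_nonempty {ω ∈ G | ⌊(b : ℝ) ^ n * Real.ofDigits ω⌋ = m} with h | h
    · simp [h]
    · obtain ⟨ω, hω, rfl⟩ := h
      exact (measure_mono fun ω' hω' ↦
        digits_eq_of_floor_eq hb (hG hω'.1) (hG hω) hω'.2).trans (hcyl ω hω)
  rcases Set.eq_empty_or_nonempty (Real.ofDigits ⁻¹' closure S ∩ G) with h | ⟨ω₀, hω₀, hω₀G⟩
  · simp [h]
  set m := ⌊(b : ℝ) ^ n * Real.ofDigits ω₀⌋ with hm
  have hsub : Real.ofDigits ⁻¹' closure S ∩ G ⊆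
      {ω ∈ G | ⌊(b : ℝ) ^ n * Real.ofDigits ω⌋ = m - 1} ∪
      {ω ∈ G | ⌊(b : ℝ) ^ n * Real.ofDigits ω⌋ = m} ∪
      {ω ∈ G | ⌊(b : ℝ) ^ n * Real.ofDigits ω⌋ = m + 1} := by
    rintro ω ⟨hω, hωG⟩
    have hbn : (0 : ℝ) < (b : ℝ) ^ n := pow_pos (by exact_mod_cast (by omega : 0 < b)) n
    have hd := (Metric.edist_le_ediam_of_mem (Set.mem_preimage.mp hω)
      (Set.mem_preimage.mp hω₀)).trans hS
    rw [edist_dist, ENNReal.ofReal_le_ofReal_iff (by positivity), Real.dist_eq] at hd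
    have hd' : |(b : ℝ) ^ n * Real.ofDigits ω - (b : ℝ) ^ n * Real.ofDigits ω₀| ≤ 1 := by
      rw [← mul_sub, abs_mul, abs_of_pos hbn]
      simpa [hbn.ne'] using mul_le_mul_of_nonneg_left hd hbn.le
    obtain ⟨h1, h2⟩ := abs_le.mp hd'
    have hle : ⌊(b : ℝ) ^ n * Real.ofDigits ω⌋ ≤ m + 1 := by
      rw [hm, ← Int.floor_add_one]
      exact Int.floor_le_floor (by linarith)
    have hge : m ≤ ⌊(b : ℝ) ^ n * Real.ofDigits ω⌋ + 1 := by
      rw [hm, ← Int.floor_add_one]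
      exact Int.floor_le_floor (by linarith)
    have hcases : ⌊(b : ℝ) ^ n * Real.ofDigits ω⌋ = m - 1 ∨
        ⌊(b : ℝ) ^ n * Real.ofDigits ω⌋ = m ∨ ⌊(b : ℝ) ^ n * Real.ofDigits ω⌋ = m + 1 := by
      omega
    rcases hcases with h | h | h
    · exact .inl (.inl ⟨hωG, h⟩)
    · exact .inl (.inr ⟨hωG, h⟩)
    · exact .inr ⟨hωG, h⟩
  calc _ ≤ _ := measure_mono hsub
    _ ≤ q + q + q := (measure_union_le _ _).trans
      (add_le_add ((measure_union_le _ _).trans (add_le_add (hcell _) (hcell _))) (hcell _))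
    _ = 3 * q := by ring

/-- The mass distribution principle for base-`b` expansions: if the mass of cylinders decays
exponentially at a rate exceeding `d * log b`, uniformly on a set `G` of positive mass, then the
numbers represented by `G` form a set of dimension at least `d`. -/
theorem le_dimH_image_ofDigits {b : ℕ} (hb : 1 < b) (P : Measure (ℕ → Fin b))
    {G : Set (ℕ → Fin b)} (hG : G ⊆ infinitelyManyZeros b) (hP : P G ≠ 0) {c : ℝ} {d : ℝ≥0}
    (hcd : d * Real.log b < c) {N : ℕ}
    (hcyl : ∀ ω ∈ G, ∀ n ≥ N,
      P {ω' | ∀ i < n, ω' i = ω i} ≤ ENNReal.ofReal (Real.exp (-(n * c)))) :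
    (d : ℝ≥0∞) ≤ dimH (Real.ofDigits '' G) := by
  have hmeas : Measurable (Real.ofDigits : (ℕ → Fin b) → ℝ) := by
    exact Real.continuous_ofDigits.measurable
  have hb0 : (0 : ℝ) < b := by exact_mod_cast (by omega : 0 < b)
  have hb1 : (1 : ℝ) < b := by exact_mod_cast hb
  have hlog : 0 < Real.log b := Real.log_pos hb1
  have hc : 0 < c := lt_of_le_of_lt (by positivity) hcd
  obtain ⟨M, hM⟩ := exists_nat_gt ((Real.log 3 + d * Real.log b) / (c - d * Real.log b))
  have key : (P.restrict G).map Real.ofDigits ≤ μH[(d : ℝ)] := by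
    refine Measure.le_hausdorffMeasure _ _ (ENNReal.ofReal (((b : ℝ) ^ (N + M))⁻¹))
      (by positivity) fun S hS ↦ ?_
    have hbound (n : ℕ) (hn : N ≤ n) (hSn : Metric.ediam S ≤ ENNReal.ofReal (((b : ℝ) ^ n)⁻¹)) :
        (P.restrict G).map Real.ofDigits S ≤ ENNReal.ofReal (3 * Real.exp (-(n * c))) := by
      refine (map_ofDigits_restrict_le hb P hG (fun ω hω ↦ hcyl ω hω n hn) hSn).trans ?_
      rw [ENNReal.ofReal_mul (by norm_num)]
      simp
    have hfin : Metric.ediam S ≠ ∞ := (hS.trans_lt ENNReal.ofReal_lt_top).ne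
    set δ := (Metric.ediam S).toReal with hδ
    have hSδ : Metric.ediam S = ENNReal.ofReal δ := (ENNReal.ofReal_toReal hfin).symm
    rcases ENNReal.toReal_nonneg.eq_or_lt' (a := δ) with h0 | hpos
    · have hlim : Tendsto (fun n : ℕ ↦ ENNReal.ofReal (3 * Real.exp (-(n * c)))) atTop (𝓝 0) := by
        rw [← ENNReal.ofReal_zero]
        refine ENNReal.tendsto_ofReal ?_
        rw [← mul_zero (3 : ℝ)]
        exact (Real.tendsto_exp_neg_atTop_nhds_zero.comp
          (tendsto_natCast_atTop_atTop.atTop_mul_const hc)).const_mul 3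
      have hz : (P.restrict G).map Real.ofDigits S ≤ 0 :=
        ge_of_tendsto hlim ((eventually_ge_atTop N).mono fun n hn ↦
          hbound n hn (by rw [hSδ, h0]; simp))
      exact hz.trans zero_le
    · have hδle : δ ≤ ((b : ℝ) ^ (N + M))⁻¹ := by
        rw [hSδ] at hS
        exact (ENNReal.ofReal_le_ofReal_iff (by positivity)).mp hS
      obtain ⟨n, hn1, hn2⟩ := exists_nat_pow_near_of_lt_one hpos
        (hδle.trans (inv_le_one_of_one_le₀ (one_le_pow₀ hb1.le)))
        (inv_pos.mpr hb0) (inv_lt_one_of_one_lt₀ hb1)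
      rw [inv_pow] at hn1 hn2
      have hNMn : N + M ≤ n := by
        have h := hn1.trans_le hδle
        rw [inv_lt_inv₀ (by positivity) (by positivity), pow_lt_pow_iff_right₀ hb1] at h
        omega
      refine (hbound n (by omega) (by rw [hSδ]; exact ENNReal.ofReal_le_ofReal hn2)).trans ?_
      rw [hSδ, ENNReal.ofReal_rpow_of_pos hpos]
      refine ENNReal.ofReal_le_ofReal ?_
      have hMn : (M : ℝ) ≤ n := by exact_mod_cast (by omega : M ≤ n)
      have hgap : 0 < c - d * Real.log b := by linarith
      have hlin : Real.log 3 + d * Real.log b ≤ n * (c - d * Real.log b) :=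
        (div_le_iff₀ hgap).mp (hM.le.trans hMn)
      calc 3 * Real.exp (-(n * c)) = Real.exp (Real.log 3 + -(n * c)) := by
            rw [Real.exp_add, Real.exp_log (by norm_num)]
        _ ≤ Real.exp (Real.log (((b : ℝ) ^ (n + 1))⁻¹) * d) := by
            rw [Real.exp_le_exp, Real.log_inv, Real.log_pow]
            push_cast
            linarith
        _ = (((b : ℝ) ^ (n + 1))⁻¹) ^ (d : ℝ) := (Real.rpow_def_of_pos (by positivity) _).symm
        _ ≤ δ ^ (d : ℝ) := Real.rpow_le_rpow (by positivity) hn1.le d.coe_nonneg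
  refine le_dimH_of_hausdorffMeasure_ne_zero fun h ↦ hP ?_
  have h1 := Measure.le_map_apply_image (μ := P.restrict G) hmeas.aemeasurable G
  rw [Measure.restrict_apply_self] at h1
  exact le_antisymm ((h1.trans (key _)).trans h.le) zero_le

theorem infinitePi_cylinder_eq_exp {α : Type*} [MeasurableSpace α]
    [MeasurableSingletonClass α] (ν : Measure α) [IsProbabilityMeasure ν]
    (hν : ∀ x, 0 < ν.real {x}) (ω : ℕ → α) (n : ℕ) :
    Measure.infinitePi (fun _ : ℕ ↦ ν) {ω' | ∀ i < n, ω' i = ω i} =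
      ENNReal.ofReal (Real.exp (∑ i ∈ Finset.range n, Real.log (ν.real {ω i}))) := by
  have hset : {ω' : ℕ → α | ∀ i < n, ω' i = ω i} =
      Set.pi (Finset.range n) (fun i ↦ {ω i}) := by
    ext ω'
    simp [Set.mem_pi]
  rw [hset, Measure.infinitePi_pi _ (fun i _ ↦ measurableSet_singleton _), Real.exp_sum,
    ENNReal.ofReal_prod_of_nonneg (fun i _ ↦ (Real.exp_pos _).le)]
  refine Finset.prod_congr rfl fun i _ ↦ ?_
  rw [Real.exp_log (hν _), ofReal_measureReal]

/-- The image under base-`b` expansion of a set of full measure for i.i.d. digits of law `ν` has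
Hausdorff dimension at least the entropy of `ν` divided by `log b`. -/
theorem entropy_div_log_le_dimH_image_ofDigits {b : ℕ} (hb : 1 < b) (ν : Measure (Fin b))
    [IsProbabilityMeasure ν] (hν : ∀ x, 0 < ν.real {x}) {G : Set (ℕ → Fin b)}
    (hG : G ⊆ infinitelyManyZeros b) (hfull : ∀ᵐ ω ∂Measure.infinitePi (fun _ : ℕ ↦ ν), ω ∈ G) :
    ENNReal.ofReal (-(∫ x, Real.log (ν.real {x}) ∂ν) / Real.log b) ≤
      dimH (Real.ofDigits '' G) := by
  have hlog : 0 < Real.log b := Real.log_pos (by exact_mod_cast hb)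
  refine ENNReal.le_of_forall_nnreal_lt fun d hd ↦ ?_
  set H := ∫ x, Real.log (ν.real {x}) ∂ν with hH
  have hd' : d * Real.log b < -H := by
    rw [← ENNReal.ofReal_coe_nnreal] at hd
    exact (lt_div_iff₀ hlog).mp ((ENNReal.ofReal_lt_ofReal_iff_of_nonneg d.coe_nonneg).mp hd)
  obtain ⟨c, hdc, hcH⟩ := exists_between hd'
  set P := Measure.infinitePi (fun _ : ℕ ↦ ν) with hP
  let E : ℕ → Set (ℕ → Fin b) := fun N ↦ {ω ∈ G | ∀ n ≥ N,
    P {ω' | ∀ i < n, ω' i = ω i} ≤ ENNReal.ofReal (Real.exp (-(n * c)))}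
  have hE : ∀ᵐ ω ∂P, ω ∈ ⋃ N, E N := by
    filter_upwards [hfull, ae_tendsto_average_infinitePi ν (fun x ↦ Real.log (ν.real {x}))]
      with ω hωG hω
    have hev := (hω.eventually_lt_const (show H < -c by linarith)).and (eventually_gt_atTop 0)
    obtain ⟨N, hN⟩ := eventually_atTop.mp hev
    refine Set.mem_iUnion.mpr ⟨N, hωG, fun n hn ↦ ?_⟩
    obtain ⟨h1, h2⟩ := hN n hn
    rw [hP, infinitePi_cylinder_eq_exp ν hν]
    refine ENNReal.ofReal_le_ofReal (Real.exp_le_exp.mpr ?_)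
    have := (div_lt_iff₀ (by exact_mod_cast h2 : (0 : ℝ) < n)).mp h1
    linarith
  have hpos : P (⋃ N, E N) ≠ 0 := by
    intro h0
    obtain ⟨ω, h1, h2⟩ := (hE.and (measure_eq_zero_iff_ae_notMem.mp h0)).exists
    exact h2 h1
  obtain ⟨N, hN⟩ := exists_measure_pos_of_not_measure_iUnion_null hpos
  refine (le_dimH_image_ofDigits hb P (fun ω hω ↦ hG hω.1) hN.ne' hdc
    (fun ω hω ↦ hω.2)).trans (dimH_mono (Set.image_mono fun ω hω ↦ hω.1))

theorem infinitelyManyZeros_of_tendsto {b : ℕ} {ω : ℕ → Fin b} {i : Fin b} (hi : (i : ℕ) = 0)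
    {p : ℝ} (hp : p ≠ 0)
    (h : Tendsto (fun n : ℕ ↦ (∑ j ∈ Finset.range n, if ω j = i then (1 : ℝ) else 0) / n)
      atTop (𝓝 p)) : ω ∈ infinitelyManyZeros b := by
  by_contra hω
  obtain ⟨N, hN⟩ := eventually_atTop.mp (not_frequently.mp hω)
  refine hp (tendsto_nhds_unique h ?_)
  refine (tendsto_const_div_atTop_nhds_zero_nat
    (∑ j ∈ Finset.range N, if ω j = i then (1 : ℝ) else 0)).congr' ?_
  filter_upwards [eventually_ge_atTop N] with n hn
  congr 1
  refine Finset.sum_subset (Finset.range_mono hn) fun j _ hj ↦ if_neg ?_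
  rintro rfl
  exact hN j (by simpa using hj) hi

/-- Eggleston's lower bound for numbers with prescribed positive ternary digit frequencies. -/
theorem entropy_div_log_three_le_dimH_freq {p : Fin 3 → ℝ} (hp : ∀ i, 0 < p i)
    (hsum : ∑ i, p i = 1) :
    ENNReal.ofReal (-(∑ i, p i * Real.log (p i)) / Real.log 3) ≤
      dimH {x ∈ Set.Icc (0 : ℝ) 1 | ∀ i : Fin 3, hasFreq (i : ℕ) x (p i)} := by
  let q : PMF (Fin 3) := PMF.ofFintype (fun i ↦ ENNReal.ofReal (p i)) (by
    rw [← ENNReal.ofReal_sum_of_nonneg (fun i _ ↦ (hp i).le), hsum, ENNReal.ofReal_one])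
  have hq (i : Fin 3) : q.toMeasure.real {i} = p i := by
    rw [Measure.real, PMF.toMeasure_apply_singleton _ _ (measurableSet_singleton _)]
    exact ENNReal.toReal_ofReal (hp i).le
  let G : Set (ℕ → Fin 3) := {ω | ∀ i : Fin 3,
    Tendsto (fun n : ℕ ↦ (∑ j ∈ Finset.range n, if ω j = i then (1 : ℝ) else 0) / n)
      atTop (𝓝 (p i))}
  have hG : G ⊆ infinitelyManyZeros 3 := fun ω hω ↦
    infinitelyManyZeros_of_tendsto (i := 0) rfl (hp 0).ne' (hω 0)
  have hfull : ∀ᵐ ω ∂Measure.infinitePi (fun _ : ℕ ↦ q.toMeasure), ω ∈ G := by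
    refine ae_all_iff.mpr fun i ↦ ?_
    have h := ae_tendsto_average_infinitePi q.toMeasure (fun x ↦ if x = i then (1 : ℝ) else 0)
    rw [integral_fintype .of_finite] at h
    simpa [hq] using h
  have h := entropy_div_log_le_dimH_image_ofDigits (by norm_num) q.toMeasure
    (fun i ↦ by rw [hq]; exact hp i) hG hfull
  rw [integral_fintype .of_finite] at h
  simp only [hq, smul_eq_mul, Nat.cast_ofNat] at h
  refine h.trans (dimH_mono ?_)
  rintro _ ⟨ω, hω, rfl⟩
  refine ⟨⟨Real.ofDigits_nonneg _, Real.ofDigits_le_one _⟩, fun i ↦ ?_⟩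
  simp only [hasFreq, digitCount_ofDigits (hG hω)]
  exact hω i

/-- Lower bound for the Hausdorff dimension of `K_a`, `a ∈ (0,2)`. -/
theorem K_a_dimH_lower_bound (a : ℝ) (ha : a ∈ Set.Ioo (0 : ℝ) 2) :
    ENNReal.ofReal
        (-(1 / Real.log 3) *
          Real.log
            (((Real.sqrt (1 + 6 * a - 3 * a ^ 2) - 1) / 3) ^
                ((Real.sqrt (1 + 6 * a - 3 * a ^ 2) - 1) / 3) *
              ((7 - 3 * a - Real.sqrt (1 + 6 * a - 3 * a ^ 2)) / 6) ^
                ((7 - 3 * a - Real.sqrt (1 + 6 * a - 3 * a ^ 2)) / 6) *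
              ((1 + 3 * a - Real.sqrt (1 + 6 * a - 3 * a ^ 2)) / 6) ^
                ((1 + 3 * a - Real.sqrt (1 + 6 * a - 3 * a ^ 2)) / 6))) ≤
      dimH {x ∈ Set.Icc (0 : ℝ) 1 |
        ∃ v0 v1 v2 : ℝ, hasFreq 0 x v0 ∧ hasFreq 1 x v1 ∧ hasFreq 2 x v2 ∧
          v1 + 2 * v2 = a} := by
  set t := Real.sqrt (1 + 6 * a - 3 * a ^ 2) with ht
  obtain ⟨ha0, ha2⟩ := ha
  have ht1 : 1 < t := by
    rw [ht, Real.lt_sqrt (by norm_num)]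
    nlinarith
  have ht7 : t < 7 - 3 * a := by
    rw [ht, Real.sqrt_lt' (by linarith)]
    nlinarith [mul_pos (sub_pos.mpr ha2) (sub_pos.mpr ha2)]
  have ht3 : t < 1 + 3 * a := by
    rw [ht, Real.sqrt_lt' (by linarith)]
    nlinarith [mul_pos ha0 ha0]
  set p : Fin 3 → ℝ := ![(7 - 3 * a - t) / 6, (t - 1) / 3, (1 + 3 * a - t) / 6] with hpdef
  have h0 : 0 < (7 - 3 * a - t) / 6 := by linarith
  have h1 : 0 < (t - 1) / 3 := by linarith
  have h2 : 0 < (1 + 3 * a - t) / 6 := by linarith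
  have hp : ∀ i, 0 < p i := by
    intro i
    fin_cases i
    exacts [h0, h1, h2]
  have hsum : ∑ i, p i = 1 := by
    simp only [hpdef, Fin.sum_univ_three, Matrix.cons_val]
    ring
  refine (le_of_eq ?_).trans ((entropy_div_log_three_le_dimH_freq hp hsum).trans (dimH_mono ?_))
  · congr 1
    rw [Real.log_mul (by positivity) (by positivity), Real.log_mul (by positivity) (by positivity),
      Real.log_rpow h1, Real.log_rpow h0, Real.log_rpow h2]
    simp only [hpdef, Fin.sum_univ_three, Matrix.cons_val]
    ring
  · rintro x ⟨hx, hfreq⟩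
    refine ⟨hx, p 0, p 1, p 2, hfreq 0, hfreq 1, hfreq 2, ?_⟩
    simp only [hpdef, Matrix.cons_val]
    ring
end

section
/- The Hausdorff dimension of the set K_1 = {x ∈ [0,1] : the frequencies ν_0(x), ν_1(x), ν_2(x) all exist and ν_1(x) + 2·ν_2(x) = 1} equals 1: dim_H(K_1) = 1. -/
open Filter

open MeasureTheory ProbabilityTheory

lemma identDistrib_indicator_of_measure_eq {Ω : Type*} [MeasurableSpace Ω] {μ : Measure Ω}
    [IsProbabilityMeasure μ] {A B : Set Ω} (hA : MeasurableSet A) (hB : MeasurableSet B)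
    (h : μ A = μ B) :
    IdentDistrib (A.indicator fun _ => (1 : ℝ)) (B.indicator fun _ => (1 : ℝ)) μ μ where
  aemeasurable_fst := (measurable_const.indicator hA).aemeasurable
  aemeasurable_snd := (measurable_const.indicator hB).aemeasurable
  map_eq := by
    classical
    ext s hs
    have hc : μ Aᶜ = μ Bᶜ := by
      rw [measure_compl hA (measure_ne_top _ _), measure_compl hB (measure_ne_top _ _), h]
    rw [Measure.map_apply (measurable_const.indicator hA) hs,
      Measure.map_apply (measurable_const.indicator hB) hs,
      Set.indicator_const_preimage_eq_union, Set.indicator_const_preimage_eq_union]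
    split_ifs <;> simp [h, hc]

lemma indepFun_indicator_one_of_indepSet {Ω : Type*} [MeasurableSpace Ω] {μ : Measure Ω}
    {A B : Set Ω} (h : IndepSet A B μ) :
    IndepFun (A.indicator fun _ => (1 : ℝ)) (B.indicator fun _ => (1 : ℝ)) μ := by
  refine Indep.indicator_indepFun (m := MeasurableSpace.generateFrom {A}) 1
    (MeasurableSpace.measurableSet_generateFrom rfl) ?_
  refine indep_of_indep_of_le_right h ?_
  rw [← measurable_iff_comap_le]
  exact measurable_const.indicator (MeasurableSpace.measurableSet_generateFrom rfl)

lemma ternDigit_three_pow_mul (x : ℝ) (n m : ℕ) :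
    ternDigit (3 ^ n * x) m = ternDigit x (n + m) := by
  unfold ternDigit
  rw [← mul_assoc, ← pow_add, add_comm]

lemma ternDigit_succ_add_one (x : ℝ) (n : ℕ) : ternDigit (x + 1) (n + 1) = ternDigit x (n + 1) := by
  unfold ternDigit
  have : (3 : ℝ) ^ (n + 1) * (x + 1) = 3 ^ (n + 1) * x + ((3 * 3 ^ n : ℤ) : ℝ) := by
    push_cast; ring
  rw [this, Int.floor_add_intCast, Int.add_mul_emod_self_left]

lemma measurable_ternDigit (n : ℕ) : Measurable fun x => ternDigit x n := by
  unfold ternDigit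
  exact (Measurable.of_discrete (f := fun z : ℤ => z % 3)).comp
    (Int.measurable_floor.comp (measurable_const_mul _))

lemma ternDigit_one_eq_iff {x : ℝ} (hx : x ∈ Set.Ico (0 : ℝ) 1) (i : Fin 3) :
    ternDigit x 1 = i ↔ x ∈ Set.Ico ((i : ℝ) / 3) ((i : ℝ) / 3 + 1 / 3) := by
  obtain ⟨h0, h1⟩ := hx
  have hf0 : 0 ≤ ⌊3 * x⌋ := Int.floor_nonneg.2 (by linarith)
  have hf1 : ⌊3 * x⌋ < 3 := Int.floor_lt.2 (by push_cast; linarith)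
  unfold ternDigit
  rw [pow_one, Int.emod_eq_of_lt hf0 hf1, Int.floor_eq_iff, Set.mem_Ico]
  push_cast
  constructor <;> rintro ⟨_, _⟩ <;> constructor <;> linarith

lemma Function.Periodic.intervalIntegral_comp_natCast_mul {f : ℝ → ℝ} (hf : Function.Periodic f 1)
    (hint : ∀ a b, IntervalIntegrable f volume a b) {N : ℕ} (hN : N ≠ 0) {M : ℕ}
    {a b : ℝ} (hab : N * b = N * a + M) :
    ∫ x in a..b, f (N * x) = (M / N : ℝ) * ∫ x in (0 : ℝ)..1, f x := by
  have hN' : (N : ℝ) ≠ 0 := by exact_mod_cast hN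
  have h := hf.intervalIntegral_add_zsmul_eq M (N * a) hint
  rw [hf.intervalIntegral_add_eq (N * a) 0, zero_add] at h
  rw [intervalIntegral.integral_comp_mul_left _ hN', hab]
  simp only [zsmul_eq_mul, mul_one, Int.cast_natCast] at h
  rw [h, smul_eq_mul]
  ring

/-- The set of reals whose `(n + 1)`-st ternary digit is `i`. -/
def digitSet (i : Fin 3) (n : ℕ) : Set ℝ := {x | ternDigit x (n + 1) = i}

lemma measurableSet_digitSet (i : Fin 3) (n : ℕ) : MeasurableSet (digitSet i n) :=
  measurable_ternDigit (n + 1) (measurableSet_singleton _)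

lemma three_pow_mul_mem_digitSet {i : Fin 3} {n m : ℕ} {x : ℝ} :
    3 ^ n * x ∈ digitSet i m ↔ x ∈ digitSet i (n + m) := by
  simp [digitSet, ternDigit_three_pow_mul, add_assoc]

lemma add_one_mem_digitSet {i : Fin 3} {n : ℕ} {x : ℝ} :
    x + 1 ∈ digitSet i n ↔ x ∈ digitSet i n := by
  simp [digitSet, ternDigit_succ_add_one]

lemma intervalIntegrable_indicator_one {A : Set ℝ} (hA : MeasurableSet A) (a b : ℝ) :
    IntervalIntegrable (A.indicator fun _ => (1 : ℝ)) volume a b :=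
  ⟨(integrable_const (1 : ℝ)).indicator hA, (integrable_const (1 : ℝ)).indicator hA⟩

lemma intervalIntegral_indicator_one {A : Set ℝ} (hA : MeasurableSet A) :
    ∫ x in (0 : ℝ)..1, A.indicator (fun _ => (1 : ℝ)) x
      = (volume.restrict (Set.Ico (0 : ℝ) 1)).real A := by
  rw [intervalIntegral.integral_of_le zero_le_one, ← integral_Ico_eq_integral_Ioc,
    integral_indicator hA]
  simp

lemma measureReal_preimage_three_pow_mul {A : Set ℝ} (hA : MeasurableSet A)
    (hper : ∀ x, x + 1 ∈ A ↔ x ∈ A) (n : ℕ) :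
    (volume.restrict (Set.Ico (0 : ℝ) 1)).real ((fun x => 3 ^ n * x) ⁻¹' A)
      = (volume.restrict (Set.Ico (0 : ℝ) 1)).real A := by
  classical
  have hf : Function.Periodic (A.indicator fun _ => (1 : ℝ)) 1 := fun x => by
    simp [Set.indicator_apply, hper]
  have h := hf.intervalIntegral_comp_natCast_mul (intervalIntegrable_indicator_one hA)
    (N := 3 ^ n) (by positivity) (M := 3 ^ n) (a := 0) (b := 1) (by simp)
  rw [← intervalIntegral_indicator_one hA,
    ← intervalIntegral_indicator_one (measurable_const_mul _ hA)]
  rw [div_self (by positivity), one_mul] at h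
  rw [← h]
  simp [Set.indicator_apply]

lemma measureReal_digitSet_inter_preimage {A : Set ℝ} (hA : MeasurableSet A)
    (hper : ∀ x, x + 1 ∈ A ↔ x ∈ A) (i : Fin 3) (k : ℕ) :
    (volume.restrict (Set.Ico (0 : ℝ) 1)).real
        (digitSet i 0 ∩ (fun x => 3 ^ (k + 1) * x) ⁻¹' A)
      = 1 / 3 * (volume.restrict (Set.Ico (0 : ℝ) 1)).real A := by
  classical
  have hf : Function.Periodic (A.indicator fun _ => (1 : ℝ)) 1 := fun x => by
    simp [Set.indicator_apply, hper]
  have hi : ((i : ℕ) : ℝ) ≤ 2 := by exact_mod_cast Nat.le_of_lt_succ i.2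
  have h := hf.intervalIntegral_comp_natCast_mul (intervalIntegrable_indicator_one hA)
    (N := 3 ^ (k + 1)) (by positivity) (M := 3 ^ k) (a := (i : ℝ) / 3) (b := (i : ℝ) / 3 + 1 / 3)
    (by push_cast; ring)
  have hpre : MeasurableSet ((fun x : ℝ => 3 ^ (k + 1) * x) ⁻¹' A) := measurable_const_mul _ hA
  have hset : digitSet i 0 ∩ (fun x : ℝ => 3 ^ (k + 1) * x) ⁻¹' A ∩ Set.Ico (0 : ℝ) 1 =
      (fun x : ℝ => 3 ^ (k + 1) * x) ⁻¹' A ∩ Set.Ico ((i : ℝ) / 3) ((i : ℝ) / 3 + 1 / 3) := by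
    ext x
    constructor
    · rintro ⟨⟨hd, hx⟩, h01⟩
      exact ⟨hx, (ternDigit_one_eq_iff h01 i).1 hd⟩
    · rintro ⟨hx, hd⟩
      have h01 : x ∈ Set.Ico (0 : ℝ) 1 :=
        ⟨le_trans (by positivity) hd.1, by linarith [hd.2]⟩
      exact ⟨⟨(ternDigit_one_eq_iff h01 i).2 hd, hx⟩, h01⟩
  rw [measureReal_restrict_apply ((measurableSet_digitSet i 0).inter hpre), hset,
    ← measureReal_restrict_apply hpre, ← intervalIntegral_indicator_one hA]
  have hq : ((3 ^ k : ℕ) : ℝ) / ((3 ^ (k + 1) : ℕ) : ℝ) = 1 / 3 := by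
    push_cast; field_simp; ring
  rw [hq] at h
  rw [← h, intervalIntegral.integral_of_le (by linarith), ← integral_Ico_eq_integral_Ioc,
    ← integral_indicator_one hpre]
  simp [Set.indicator_apply]

instance isProbabilityMeasure_restrict_Ico_zero_one :
    IsProbabilityMeasure ((volume : Measure ℝ).restrict (Set.Ico 0 1)) :=
  ⟨by simp⟩

lemma measureReal_digitSet (i : Fin 3) (n : ℕ) :
    (volume.restrict (Set.Ico (0 : ℝ) 1)).real (digitSet i n) = 1 / 3 := by
  have h := measureReal_preimage_three_pow_mul (measurableSet_digitSet i 0)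
    (fun _ => add_one_mem_digitSet) n
  have h' := measureReal_digitSet_inter_preimage (A := Set.univ) .univ (by simp) i 0
  rw [Set.preimage_univ, Set.inter_univ, probReal_univ, mul_one] at h'
  rw [← h', ← h]
  congr 1
  ext x
  exact (three_pow_mul_mem_digitSet (i := i) (n := n) (m := 0)).symm

lemma measureReal_digitSet_inter_digitSet (i : Fin 3) (n k : ℕ) :
    (volume.restrict (Set.Ico (0 : ℝ) 1)).real (digitSet i n ∩ digitSet i (n + (k + 1)))
      = 1 / 3 * (1 / 3) := by
  have h := measureReal_preimage_three_pow_mul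
    ((measurableSet_digitSet i 0).inter (measurableSet_digitSet i (k + 1)))
    (fun _ => and_congr add_one_mem_digitSet add_one_mem_digitSet) n
  have h' := measureReal_digitSet_inter_preimage (measurableSet_digitSet i 0)
    (fun _ => add_one_mem_digitSet) i k
  rw [measureReal_digitSet] at h'
  rw [← h']
  refine Eq.trans ?_ (h.trans ?_) <;> congr 1 <;> ext x
  · simp [three_pow_mul_mem_digitSet]
  · simp [three_pow_mul_mem_digitSet]

lemma indepSet_digitSet_of_lt (i : Fin 3) {n m : ℕ} (hnm : n < m) :
    IndepSet (digitSet i n) (digitSet i m) (volume.restrict (Set.Ico (0 : ℝ) 1)) := by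
  obtain ⟨k, rfl⟩ := Nat.exists_eq_add_of_lt hnm
  refine (indepSet_iff_measure_inter_eq_mul (measurableSet_digitSet i n)
    (measurableSet_digitSet i _) _).2 ?_
  rw [← ENNReal.toReal_eq_toReal_iff' (measure_ne_top _ _) (by finiteness), ENNReal.toReal_mul]
  change Measure.real _ _ = Measure.real _ _ * Measure.real _ _
  rw [measureReal_digitSet, measureReal_digitSet]
  exact measureReal_digitSet_inter_digitSet i n k

lemma sum_indicator_digitSet (i : Fin 3) (x : ℝ) (n : ℕ) :
    ∑ k ∈ Finset.range n, (digitSet i k).indicator (fun _ => (1 : ℝ)) x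
      = digitCount (i : ℕ) x n := by
  classical
  rw [digitCount, Finset.card_filter, Finset.range_eq_Ico,
    ← Finset.Ico_add_one_right_eq_Icc 1 n, ← zero_add 1, ← Finset.sum_Ico_add' _ 0 n 1]
  simp [Set.indicator_apply, digitSet]

/-- Almost every real in the unit interval has all ternary digits with equal frequency. -/
lemma ae_hasFreq_one_third (i : Fin 3) :
    ∀ᵐ x ∂(volume.restrict (Set.Ico (0 : ℝ) 1)), hasFreq (i : ℕ) x (1 / 3) := by
  have h := strong_law_ae_real (μ := volume.restrict (Set.Ico (0 : ℝ) 1))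
    (fun n => (digitSet i n).indicator fun _ => (1 : ℝ))
    ((integrable_const (1 : ℝ)).indicator (measurableSet_digitSet i 0))
    (fun n m hnm => by
      rcases hnm.lt_or_gt with h | h
      · exact indepFun_indicator_one_of_indepSet (indepSet_digitSet_of_lt i h)
      · exact (indepFun_indicator_one_of_indepSet (indepSet_digitSet_of_lt i h)).symm)
    (fun n => identDistrib_indicator_of_measure_eq (measurableSet_digitSet i n)
      (measurableSet_digitSet i 0)
      ((ENNReal.toReal_eq_toReal_iff' (measure_ne_top _ _) (measure_ne_top _ _)).1
        ((measureReal_digitSet i n).trans (measureReal_digitSet i 0).symm)))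
  have hmean : ∫ x, (digitSet i 0).indicator (fun _ => (1 : ℝ)) x
      ∂(volume.restrict (Set.Ico (0 : ℝ) 1)) = 1 / 3 :=
    (integral_indicator_one (measurableSet_digitSet i 0)).trans (measureReal_digitSet i 0)
  filter_upwards [h] with x hx
  simpa only [hasFreq, hmean, sum_indicator_digitSet] using hx

/-- The Hausdorff dimension of `K_1` equals 1. -/
theorem K_one_dimH :
    dimH {x ∈ Set.Icc (0 : ℝ) 1 |
      ∃ v0 v1 v2 : ℝ, hasFreq 0 x v0 ∧ hasFreq 1 x v1 ∧ hasFreq 2 x v2 ∧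
        v1 + 2 * v2 = 1} = 1 := by
  set K := {x ∈ Set.Icc (0 : ℝ) 1 |
      ∃ v0 v1 v2 : ℝ, hasFreq 0 x v0 ∧ hasFreq 1 x v1 ∧ hasFreq 2 x v2 ∧
        v1 + 2 * v2 = 1} with hK
  refine le_antisymm ((dimH_mono (Set.subset_univ K)).trans_eq Real.dimH_univ) ?_
  have hae : ∀ᵐ x ∂(volume.restrict (Set.Ico (0 : ℝ) 1)), x ∈ K := by
    filter_upwards [ae_hasFreq_one_third 0, ae_hasFreq_one_third 1, ae_hasFreq_one_third 2,
      ae_restrict_mem measurableSet_Ico] with x h0 h1 h2 hx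
    exact ⟨Set.Ico_subset_Icc_self hx, 1 / 3, 1 / 3, 1 / 3, h0, h1, h2, by norm_num⟩
  have hpos : (volume : Measure ℝ) K ≠ 0 := fun h => by
    have hK0 : ∀ᵐ x ∂(volume.restrict (Set.Ico (0 : ℝ) 1)), x ∉ K :=
      ae_restrict_of_ae (measure_eq_zero_iff_ae_notMem.1 h)
    obtain ⟨x, hx, hx'⟩ := (hae.and hK0).exists
    exact hx' hx
  have h := le_dimH_of_hausdorffMeasure_ne_zero (d := 1) (s := K)
    (by rwa [NNReal.coe_one, hausdorffMeasure_real])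
  simpa using h
end

section
/- Let τ_0, τ_1, τ_2 be nonnegative real numbers with τ_0 + τ_1 + τ_2 = 1. Then the Besicovitch–Eggleston set E[τ_0, τ_1, τ_2] = {x ∈ [0,1] : for each i ∈ {0,1,2} the frequency ν_i(x) exists and ν_i(x) = τ_i} has the cardinality of the continuum. -/
open Filter

theorem Real.ofDigits_lt_one_s19 {b : ℕ} {a : ℕ → Fin b} {n : ℕ} (hn : (a n : ℕ) + 1 < b) :
    Real.ofDigits a < 1 := by
  have hb : 1 < b := by omega
  rw [← Real.ofDigits_const_last_eq_one' hb]
  have hterm : ∀ i, Real.ofDigitsTerm (fun _ ↦ (⟨b - 1, Nat.sub_one_lt_of_lt hb⟩ : Fin b)) i =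
      (b - 1) * ((b : ℝ) ^ (i + 1))⁻¹ := by
    intro i
    simp [Real.ofDigitsTerm, Nat.cast_sub hb.le]
  refine Summable.tsum_lt_tsum (i := n) (fun i ↦ ?_) ?_ Real.summable_ofDigitsTerm
    Real.summable_ofDigitsTerm
  · rw [hterm]
    exact Real.ofDigitsTerm_le
  · rw [hterm]
    unfold Real.ofDigitsTerm
    have hb' : (0 : ℝ) < b := by exact_mod_cast hb.le
    have hn' : ((a n : ℕ) : ℝ) + 1 < b := by exact_mod_cast hn
    gcongr
    linarith

theorem Real.exists_int_pow_mul_ofDigits (e : ℕ → Fin 3) (n : ℕ) :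
    ∃ m : ℤ, (3 : ℝ) ^ n * Real.ofDigits e = m + Real.ofDigits (fun i ↦ e (i + n)) := by
  induction n with
  | zero => exact ⟨0, by simp⟩
  | succ n ih =>
    obtain ⟨m, hm⟩ := ih
    refine ⟨3 * m + (e n : ℕ), ?_⟩
    have h := Real.ofDigits_eq_sum_add_ofDigits (fun i ↦ e (i + n)) 1
    simp only [Finset.range_one, Finset.sum_singleton, Real.ofDigitsTerm, zero_add, pow_one,
      Nat.cast_ofNat, add_assoc, add_comm 1 n] at h
    rw [pow_succ', mul_assoc, hm, h]
    push_cast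
    ring

theorem ternDigit_ofDigits_s19 {e : ℕ → Fin 3} (he : ∃ᶠ n in atTop, e n ≠ 2) (n : ℕ) :
    ternDigit (Real.ofDigits e) (n + 1) = (e n : ℕ) := by
  obtain ⟨m, hm⟩ := Real.exists_int_pow_mul_ofDigits e n
  have h := Real.ofDigits_eq_sum_add_ofDigits (fun i ↦ e (i + n)) 1
  simp only [Finset.range_one, Finset.sum_singleton, Real.ofDigitsTerm, zero_add, pow_one,
    Nat.cast_ofNat, add_assoc, add_comm 1 n] at h
  have hlt : Real.ofDigits (fun i ↦ e (i + (n + 1))) < 1 := by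
    obtain ⟨k, hk, hek⟩ := frequently_atTop.1 he (n + 1)
    refine Real.ofDigits_lt_one_s19 (n := k - (n + 1)) ?_
    rw [Nat.sub_add_cancel hk]
    omega
  have hfloor : ⌊(3 : ℝ) ^ (n + 1) * Real.ofDigits e⌋ = 3 * m + (e n : ℕ) := by
    rw [Int.floor_eq_iff, pow_succ', mul_assoc, hm, h]
    have := Real.ofDigits_nonneg (fun i ↦ e (i + (n + 1)))
    push_cast
    constructor <;> linarith
  rw [ternDigit, hfloor]
  omega

theorem digitCount_ofDigits_s19 {e : ℕ → Fin 3} (he : ∃ᶠ n in atTop, e n ≠ 2) (i : Fin 3) (k : ℕ) :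
    digitCount (i : ℕ) (Real.ofDigits e) k = Nat.count (fun n ↦ e n = i) k := by
  have hmap : Finset.Icc 1 k = (Finset.range k).map (addRightEmbedding 1) := by
    rw [Finset.range_eq_Ico, Finset.map_add_right_Ico, zero_add]
    ext
    simp
  rw [digitCount, Nat.count_eq_card_filter_range, hmap, Finset.filter_map, Finset.card_map]
  congr 1
  refine Finset.filter_congr fun n _ ↦ ?_
  simp only [Function.comp_apply, addRightEmbedding_apply, ternDigit_ofDigits_s19 he]
  omega

theorem hasFreq_of_abs_sub_le {i : ℤ} {x t C : ℝ}
    (h : ∀ k : ℕ, |(digitCount i x k : ℝ) - k * t| ≤ C + √k) : hasFreq i x t := by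
  rw [hasFreq, tendsto_iff_dist_tendsto_zero]
  have hsqrt : Tendsto (fun k : ℕ ↦ (√(k : ℝ))⁻¹) atTop (nhds 0) :=
    (Real.tendsto_sqrt_atTop.comp tendsto_natCast_atTop_atTop).inv_tendsto_atTop
  have hbound : Tendsto (fun k : ℕ ↦ C / k + (√(k : ℝ))⁻¹) atTop (nhds 0) := by
    simpa using (tendsto_const_div_atTop_nhds_zero_nat C).add hsqrt
  refine squeeze_zero' (.of_forall fun _ ↦ dist_nonneg) ?_ hbound
  filter_upwards [eventually_gt_atTop 0] with k hk
  have hk' : (0 : ℝ) < k := by exact_mod_cast hk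
  have heq : (digitCount i x k : ℝ) / k - t = (digitCount i x k - k * t) / k := by
    field_simp
  rw [Real.dist_eq, heq, abs_div, abs_of_pos hk', ← Real.sqrt_div_self, ← add_div]
  gcongr
  exact h k

theorem Nat.floor_succ_mul_eq_or {u : ℝ} (hu : 0 ≤ u) (hu' : u ≤ 1) (n : ℕ) :
    ⌊((n + 1 : ℕ) : ℝ) * u⌋₊ = ⌊(n : ℝ) * u⌋₊ ∨
      ⌊((n + 1 : ℕ) : ℝ) * u⌋₊ = ⌊(n : ℝ) * u⌋₊ + 1 := by
  have hle : ⌊(n : ℝ) * u⌋₊ ≤ ⌊((n + 1 : ℕ) : ℝ) * u⌋₊ := by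
    gcongr
    simp
  have hle' : ⌊((n + 1 : ℕ) : ℝ) * u⌋₊ ≤ ⌊(n : ℝ) * u⌋₊ + 1 := by
    rw [← Nat.floor_add_one (by positivity)]
    gcongr
    push_cast
    linarith
  omega

/-- There is a ternary sequence whose digit counts stay within bounded distance of the prescribed
linear functions. -/
theorem exists_abs_count_sub_le {t : Fin 3 → ℝ} (ht : ∀ i, 0 ≤ t i) (hsum : ∑ i, t i = 1) :
    ∃ d : ℕ → Fin 3, ∀ i k, |(Nat.count (fun n ↦ d n = i) k : ℝ) - k * t i| ≤ 3 := by
  have ht0 := ht 0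
  have ht1 := ht 1
  have ht2 := ht 2
  rw [Fin.sum_univ_three] at hsum
  obtain ⟨u, hu, hu', hut⟩ : ∃ u : ℝ, 0 ≤ u ∧ u ≤ 1 ∧ (1 - t 0) * u = t 1 := by
    rcases eq_or_lt_of_le (show t 0 ≤ 1 by linarith) with h | h
    · exact ⟨0, le_rfl, zero_le_one, by linarith⟩
    · have hpos : 0 < 1 - t 0 := by linarith
      exact ⟨t 1 / (1 - t 0), by positivity, (div_le_one hpos).2 (by linarith),
        mul_div_cancel₀ _ hpos.ne'⟩
  let a : ℕ → ℕ := fun k ↦ ⌊(k : ℝ) * t 0⌋₊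
  let m : ℕ → ℕ := fun k ↦ k - a k
  let b : ℕ → ℕ := fun k ↦ ⌊(m k : ℝ) * u⌋₊
  have ha : ∀ k, a (k + 1) = a k ∨ a (k + 1) = a k + 1 :=
    Nat.floor_succ_mul_eq_or ht0 (by linarith)
  have hak : ∀ k, a k ≤ k := fun k ↦
    Nat.floor_le_of_le (mul_le_of_le_one_right (by positivity) (by linarith))
  have hbk : ∀ k, b k ≤ m k := fun k ↦
    Nat.floor_le_of_le (mul_le_of_le_one_right (by positivity) hu')
  have hb : ∀ k, (a (k + 1) = a k + 1 ∧ b (k + 1) = b k) ∨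
      (a (k + 1) = a k ∧ (b (k + 1) = b k ∨ b (k + 1) = b k + 1)) := by
    intro k
    have hk := hak k
    rcases ha k with h | h
    · have hm : m (k + 1) = m k + 1 := by simp only [m]; omega
      refine .inr ⟨h, ?_⟩
      simp only [b, hm]
      exact Nat.floor_succ_mul_eq_or hu hu' (m k)
    · have hm : m (k + 1) = m k := by simp only [m]; omega
      exact .inl ⟨h, by simp only [b, hm]⟩
  let d : ℕ → Fin 3 := fun n ↦
    if a (n + 1) = a n + 1 then 0 else if b (n + 1) = b n + 1 then 1 else 2
  have hcount : ∀ k, Nat.count (fun n ↦ d n = 0) k = a k ∧ Nat.count (fun n ↦ d n = 1) k = b k ∧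
      a k + b k + Nat.count (fun n ↦ d n = 2) k = k := by
    intro k
    induction k with
    | zero => simp [a, b, m]
    | succ k ih =>
      obtain ⟨h0, h1, h2⟩ := ih
      simp only [Nat.count_succ]
      rcases hb k with ⟨h, h'⟩ | ⟨h, h' | h'⟩
      · have hd : d k = 0 := by simp [d, h]
        simp [hd]
        omega
      · have hd : d k = 2 := by simp [d, h, h']
        simp [hd]
        omega
      · have hd : d k = 1 := by simp [d, h, h']
        simp [hd]
        omega
  refine ⟨d, fun i k ↦ ?_⟩
  obtain ⟨h0, h1, h2⟩ := hcount k
  have hsub : (m k : ℝ) = k - a k := Nat.cast_sub (hak k)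
  have ha1 : (a k : ℝ) ≤ k * t 0 := Nat.floor_le (by positivity)
  have ha2 : k * t 0 < a k + 1 := Nat.lt_floor_add_one _
  have hb1 : (b k : ℝ) ≤ m k * u := Nat.floor_le (by positivity)
  have hb2 : m k * u < b k + 1 := Nat.lt_floor_add_one _
  have hmu : m k * u = k * t 1 + (k * t 0 - a k) * u := by
    rw [hsub, ← hut]
    ring
  have herr : 0 ≤ (k * t 0 - a k) * u := mul_nonneg (by linarith) hu
  have herr' : (k * t 0 - a k) * u ≤ 1 := mul_le_one₀ (by linarith) hu hu'
  have hk : (k : ℝ) * t 0 + k * t 1 + k * t 2 = k := by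
    rw [← mul_add, ← mul_add, hsum, mul_one]
  have h2' : (a k : ℝ) + b k + (Nat.count (fun n ↦ d n = 2) k : ℕ) = k := by exact_mod_cast h2
  rw [abs_le]
  fin_cases i
  · simp only [Fin.zero_eta, h0]
    constructor <;> linarith
  · simp only [Fin.mk_one, h1]
    constructor <;> linarith
  · simp only [Fin.reduceFinMk]
    constructor <;> linarith

theorem abs_count_sub_count_le {α : Type*} [DecidableEq α] {d e : ℕ → α} {p : ℕ → Prop}
    [DecidablePred p] (h : ∀ n, ¬ p n → e n = d n) (i : α) (k : ℕ) :
    |(Nat.count (fun n ↦ e n = i) k : ℝ) - Nat.count (fun n ↦ d n = i) k| ≤ Nat.count p k := by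
  induction k with
  | zero => simp
  | succ k ih =>
    simp only [Nat.count_succ]
    rw [abs_le] at ih ⊢
    have := h k
    push_cast
    split_ifs <;> first | (constructor <;> linarith) | simp_all

theorem Nat.count_isSquare_le (k : ℕ) : Nat.count (fun n ↦ IsSquare n) k ≤ k.sqrt + 1 := by
  rw [Nat.count_eq_card_filter_range, ← Finset.card_range (k.sqrt + 1)]
  refine (Finset.card_le_card ?_).trans
    (Finset.card_image_le (s := Finset.range (k.sqrt + 1)) (f := fun j ↦ j * j))
  intro n hn
  obtain ⟨hnk, j, rfl⟩ := by simpa using hn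
  refine Finset.mem_image.2 ⟨j, Finset.mem_range.2 ?_, rfl⟩
  exact Nat.lt_succ_of_le (Nat.le_sqrt.2 hnk.le)

/-- Overwrite the terms of `d` at square indices by the bits `c`. -/
def overwriteSquares (d : ℕ → Fin 3) (c : ℕ → Bool) (n : ℕ) : Fin 3 :=
  if IsSquare n then (if c n.sqrt then 1 else 0) else d n

theorem overwriteSquares_mul_self (d : ℕ → Fin 3) (c : ℕ → Bool) (j : ℕ) :
    overwriteSquares d c (j * j) = if c j then 1 else 0 := by
  simp [overwriteSquares]

theorem frequently_overwriteSquares_ne_two (d : ℕ → Fin 3) (c : ℕ → Bool) :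
    ∃ᶠ n in atTop, overwriteSquares d c n ≠ 2 := by
  refine frequently_atTop.2 fun n ↦ ⟨n * n, Nat.le_mul_self n, ?_⟩
  rw [overwriteSquares_mul_self]
  split_ifs <;> decide

theorem ofDigits_overwriteSquares_injective (d : ℕ → Fin 3) :
    Function.Injective fun c ↦ Real.ofDigits (overwriteSquares d c) := by
  intro c c' h
  funext j
  have hj := congrArg (fun x ↦ ternDigit x (j * j + 1)) h
  simp only [ternDigit_ofDigits_s19 (frequently_overwriteSquares_ne_two d _),
    overwriteSquares_mul_self] at hj
  cases hc : c j <;> cases hc' : c' j <;> simp_all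

theorem hasFreq_ofDigits_overwriteSquares {d : ℕ → Fin 3} {i : Fin 3} {t : ℝ}
    (hd : ∀ k, |(Nat.count (fun n ↦ d n = i) k : ℝ) - k * t| ≤ 3) (c : ℕ → Bool) :
    hasFreq (i : ℕ) (Real.ofDigits (overwriteSquares d c)) t := by
  refine hasFreq_of_abs_sub_le (C := 4) fun k ↦ ?_
  rw [digitCount_ofDigits_s19 (frequently_overwriteSquares_ne_two d c)]
  have hdiff := abs_count_sub_count_le (p := fun n ↦ IsSquare n) (e := overwriteSquares d c)
    (d := d) (fun n hn ↦ if_neg hn) i k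
  have hsq : (Nat.count (fun n ↦ IsSquare n) k : ℝ) ≤ k.sqrt + 1 := by
    exact_mod_cast Nat.count_isSquare_le k
  have hsqrt := Real.nat_sqrt_le_real_sqrt (a := k)
  have htri := abs_sub_le (Nat.count (fun n ↦ overwriteSquares d c n = i) k : ℝ)
    (Nat.count (fun n ↦ d n = i) k) (k * t)
  linarith [hd k]

/-- Every Besicovitch–Eggleston set `E[τ₀,τ₁,τ₂]` with `τ₀ + τ₁ + τ₂ = 1`,
`τᵢ ≥ 0`, has the cardinality of the continuum. -/
theorem besicovitch_eggleston_continuum (t0 t1 t2 : ℝ)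
    (h0 : 0 ≤ t0) (h1 : 0 ≤ t1) (h2 : 0 ≤ t2) (hsum : t0 + t1 + t2 = 1) :
    Cardinal.mk ↥{x ∈ Set.Icc (0 : ℝ) 1 |
      hasFreq 0 x t0 ∧ hasFreq 1 x t1 ∧ hasFreq 2 x t2} = Cardinal.continuum := by
  refine le_antisymm ((Cardinal.mk_set_le _).trans_eq Cardinal.mk_real) ?_
  obtain ⟨d, hd⟩ := exists_abs_count_sub_le (t := ![t0, t1, t2])
    (fun i ↦ by fin_cases i <;> simpa) (by simpa [Fin.sum_univ_three] using hsum)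
  have hfreq : ∀ (c : ℕ → Bool) (i : Fin 3),
      hasFreq (i : ℕ) (Real.ofDigits (overwriteSquares d c)) (![t0, t1, t2] i) :=
    fun c i ↦ hasFreq_ofDigits_overwriteSquares (hd i) c
  have hmem : ∀ c : ℕ → Bool, Real.ofDigits (overwriteSquares d c) ∈
      {x ∈ Set.Icc (0 : ℝ) 1 | hasFreq 0 x t0 ∧ hasFreq 1 x t1 ∧ hasFreq 2 x t2} := fun c ↦
    ⟨⟨Real.ofDigits_nonneg _, Real.ofDigits_le_one _⟩, hfreq c 0, hfreq c 1, hfreq c 2⟩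
  have hcard := Cardinal.mk_le_of_injective
    (f := Set.codRestrict (fun c ↦ Real.ofDigits (overwriteSquares d c)) _ hmem)
    ((ofDigits_overwriteSquares_injective d).codRestrict hmem)
  simpa using hcard
end
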